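/- For all integers s ≥ 0 and all integers k ≥ 2^s: x (2^s) k = 2^{−s}·∑_{j=1}^{2^s} (−1)^{j+1}·sin((2j−1)π/2^{s+1})·(2 + 2·cos((2j−1)π/2^{s+1}))^{k−1}. -/

import Mathlib

open Real

/-- `xfun n k` is the multiplicity of the indecomposable tilting module `T(2n)` in
`V^{⊗2k}`, where `V` is the natural representation of `SL₂` in characteristic 2. -/
def xfun : ℕ → ℕ → ℕ
  | 0, 0 => 1
  | 0, _ + 1 => 0
  | _ + 1, 0 => 0
  | n + 1, k + 1 =>
      xfun n k + 2 * ∑ i ∈ Finset.range ((n + 1).factorization 2 + 1), xfun (n + 2 ^ i) k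

/-- Characters of the tilting modules `T(m)`, as functions of the character `u` of `V`. -/
noncomputable def tiltR : ℕ → ℝ → ℝ
  | 0, _ => 1
  | n + 1, u => (if n % 2 = 0 then u else u ^ 2) * tiltR (n / 2) (u ^ 2 - 2)
decreasing_by omega

lemma tiltR_zero (u : ℝ) : tiltR 0 u = 1 := by rw [tiltR]

lemma tiltR_odd (m : ℕ) (u : ℝ) : tiltR (2 * m + 1) u = u * tiltR m (u ^ 2 - 2) := by
  rw [tiltR, if_pos (by omega), show 2 * m / 2 = m by omega]

lemma tiltR_even (m : ℕ) (u : ℝ) : tiltR (2 * m + 2) u = u ^ 2 * tiltR m (u ^ 2 - 2) := by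
  rw [tiltR, if_neg (by omega), show (2 * m + 1) / 2 = m by omega]

lemma tiltR_column (M : ℕ) : ∀ (N : ℕ) (u : ℝ), M < N →
    (u + 2) * tiltR M u = tiltR (M + 1) u + 2 * ∑ i ∈ Finset.range N,
      if 2 ^ i ∣ M + 2 ∧ 2 ^ i ≤ M + 1 then tiltR (M + 1 - 2 ^ i) u else 0 := by
  induction M using Nat.strong_induction_on with
  | _ M ih =>
    intro N u hN
    obtain ⟨N, rfl⟩ : ∃ N', N = N' + 1 := ⟨N - 1, by omega⟩
    rw [Finset.sum_range_succ']
    have h0 : (if 2 ^ 0 ∣ M + 2 ∧ 2 ^ 0 ≤ M + 1 then tiltR (M + 1 - 2 ^ 0) u else 0)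
        = tiltR M u := by
      rw [if_pos ⟨by simp, by simp⟩]; simp
    rw [h0]
    rcases Nat.eq_zero_or_pos M with rfl | hM
    · have : ∀ i ∈ Finset.range N, (if 2 ^ (i + 1) ∣ 0 + 2 ∧ 2 ^ (i + 1) ≤ 0 + 1
          then tiltR (0 + 1 - 2 ^ (i + 1)) u else 0) = 0 := by
        intro i _
        rw [if_neg]
        rintro ⟨_, h⟩
        have := Nat.one_le_two_pow (n := i)
        rw [pow_succ] at h
        omega
      rw [Finset.sum_eq_zero this, tiltR_zero, show 0 + 1 = 2 * 0 + 1 from rfl, tiltR_odd,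
        tiltR_zero]
      ring
    rcases Nat.even_or_odd' M with ⟨m, rfl | rfl⟩
    · obtain ⟨m, rfl⟩ : ∃ m', m = m' + 1 := ⟨m - 1, by omega⟩
      have : ∀ i ∈ Finset.range N, (if 2 ^ (i + 1) ∣ 2 * (m + 1) + 2 ∧
          2 ^ (i + 1) ≤ 2 * (m + 1) + 1
          then tiltR (2 * (m + 1) + 1 - 2 ^ (i + 1)) u else 0) =
          u * (if 2 ^ i ∣ m + 2 ∧ 2 ^ i ≤ m + 1 then tiltR (m + 1 - 2 ^ i) (u ^ 2 - 2) else 0) := by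
        intro i _
        have e : (2 ^ (i + 1) ∣ 2 * (m + 1) + 2 ∧ 2 ^ (i + 1) ≤ 2 * (m + 1) + 1) ↔
            (2 ^ i ∣ m + 2 ∧ 2 ^ i ≤ m + 1) := by
          rw [pow_succ', show 2 * (m + 1) + 2 = 2 * (m + 2) by ring,
            Nat.mul_dvd_mul_iff_left (by norm_num)]
          constructor
          · rintro ⟨h, h'⟩; exact ⟨h, by omega⟩
          · rintro ⟨h, h'⟩; exact ⟨h, by omega⟩
        by_cases h : 2 ^ i ∣ m + 2 ∧ 2 ^ i ≤ m + 1
        · rw [if_pos h, if_pos (e.2 h), ← tiltR_odd]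
          congr 1
          have := h.2
          rw [pow_succ']
          omega
        · rw [if_neg h, if_neg (fun h' => h (e.1 h'))]; ring
      rw [Finset.sum_congr rfl this, ← Finset.mul_sum]
      have key := ih m (by omega) N (u ^ 2 - 2) (by omega)
      rw [tiltR_odd, show 2 * (m + 1) = 2 * m + 2 by ring, tiltR_even]
      linear_combination u * key
    · have : ∀ i ∈ Finset.range N, (if 2 ^ (i + 1) ∣ 2 * m + 1 + 2 ∧
          2 ^ (i + 1) ≤ 2 * m + 1 + 1
          then tiltR (2 * m + 1 + 1 - 2 ^ (i + 1)) u else 0) = 0 := by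
        intro i _
        rw [if_neg]
        rintro ⟨h, _⟩
        have := (Dvd.intro _ (pow_succ' 2 i).symm).trans h
        omega
      rw [Finset.sum_eq_zero this, show 2 * m + 1 + 1 = 2 * m + 2 from rfl, tiltR_odd, tiltR_even]
      ring

lemma xfun_eq_zero (k : ℕ) : ∀ n, k < n → xfun n k = 0 := by
  induction k with
  | zero =>
    intro n hn
    obtain ⟨n, rfl⟩ : ∃ n', n = n' + 1 := ⟨n - 1, by omega⟩
    rw [xfun]
  | succ k ih =>
    intro n hn
    obtain ⟨n, rfl⟩ : ∃ n', n = n' + 1 := ⟨n - 1, by omega⟩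
    have h : ∀ i ∈ Finset.range ((n + 1).factorization 2 + 1), xfun (n + 2 ^ i) k = 0 := by
      intro i _
      exact ih _ (by have := Nat.one_le_two_pow (n := i); omega)
    rw [xfun, ih n (by omega), Finset.sum_eq_zero h]; rfl

lemma xfun_rec (n k N : ℕ) (hN : n < N) :
    (xfun (n + 1) (k + 1) : ℝ) = xfun n k + 2 * ∑ i ∈ Finset.range N,
      if 2 ^ i ∣ n + 1 then (xfun (n + 2 ^ i) k : ℝ) else 0 := by
  rw [xfun]
  push_cast
  congr 2
  rw [← Finset.sum_filter]
  apply Finset.sum_congr _ (fun _ _ => rfl)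
  ext i
  simp only [Finset.mem_range, Finset.mem_filter]
  rw [Nat.prime_two.pow_dvd_iff_le_factorization (by omega)]
  have := Nat.factorization_lt (n := n + 1) 2 (by omega)
  omega

lemma sum_shift (N b : ℕ) (g x : ℕ → ℝ) (hx : ∀ m, N ≤ m → x m = 0) :
    ∑ n ∈ Finset.range N, g n * x (n + b) =
      ∑ m ∈ Finset.range N, if b ≤ m then g (m - b) * x m else 0 := by
  have h1 : ∑ n ∈ Finset.range N, g n * x (n + b) =
      ∑ m ∈ Finset.range (b + N), if b ≤ m then g (m - b) * x m else 0 := by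
    have h0 : ∀ m ∈ Finset.range b, (if b ≤ m then g (m - b) * x m else 0) = 0 := by
      intro i hi
      rw [if_neg]
      simpa using hi
    rw [Finset.sum_range_add, Finset.sum_eq_zero h0, zero_add]
    · apply Finset.sum_congr rfl
      intro n _
      rw [if_pos (by omega), show b + n - b = n by omega, add_comm b n]
  rw [h1]
  symm
  apply Finset.sum_subset
  · intro i hi
    simp only [Finset.mem_range] at *
    omega
  · intro i _ hi
    simp only [Finset.mem_range, not_lt] at hi
    rw [hx i hi]
    simp

lemma pow_expand (k : ℕ) : ∀ (N : ℕ) (u : ℝ), k < N →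
    (u + 2) ^ k = ∑ m ∈ Finset.range N, (xfun (m + 1) (k + 1) : ℝ) * tiltR m u := by
  induction k with
  | zero =>
    intro N u hN
    rw [Finset.sum_eq_single 0]
    · simp [xfun, tiltR_zero]
    · intro m _ hm
      rw [xfun_eq_zero _ _ (by omega)]; simp
    · intro h; simp at h; omega
  | succ k ih =>
    intro N u hN
    obtain ⟨N, rfl⟩ : ∃ N', N = N' + 1 := ⟨N - 1, by omega⟩
    have e1 : ∀ m ∈ Finset.range (N + 1), (xfun (m + 1) (k + 1 + 1) : ℝ) * tiltR m u =
        xfun m (k + 1) * tiltR m u + 2 * ∑ i ∈ Finset.range (N + 1),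
          (if 2 ^ i ∣ m + 1 then tiltR m u else 0) * xfun (m + (2 ^ i - 1) + 1) (k + 1) := by
      intro m hm
      rw [xfun_rec m (k + 1) (N + 1) (by simpa using hm), add_mul, mul_assoc, Finset.sum_mul]
      congr 2
      apply Finset.sum_congr rfl
      intro i _
      have := Nat.one_le_two_pow (n := i)
      rw [show m + (2 ^ i - 1) + 1 = m + 2 ^ i by omega]
      split_ifs <;> ring
    rw [Finset.sum_congr rfl e1, Finset.sum_add_distrib, ← Finset.mul_sum, Finset.sum_comm]
    have e2 : ∀ i ∈ Finset.range (N + 1), ∑ m ∈ Finset.range (N + 1),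
        (if 2 ^ i ∣ m + 1 then tiltR m u else 0) * (xfun (m + (2 ^ i - 1) + 1) (k + 1) : ℝ) =
        ∑ m ∈ Finset.range (N + 1), (xfun (m + 1) (k + 1) : ℝ) *
          (if 2 ^ i ∣ m + 2 ∧ 2 ^ i ≤ m + 1 then tiltR (m + 1 - 2 ^ i) u else 0) := by
      intro i _
      rw [sum_shift (N + 1) (2 ^ i - 1) (fun m => if 2 ^ i ∣ m + 1 then tiltR m u else 0)
        (fun m => (xfun (m + 1) (k + 1) : ℝ))
        (by intro m hm; rw [xfun_eq_zero _ _ (by omega)]; simp)]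
      apply Finset.sum_congr rfl
      intro m _
      have h1 := Nat.one_le_two_pow (n := i)
      by_cases h : 2 ^ i ≤ m + 1
      · rw [if_pos (by omega), show m - (2 ^ i - 1) = m + 1 - 2 ^ i by omega]
        have : 2 ^ i ∣ m + 1 - 2 ^ i + 1 ↔ 2 ^ i ∣ m + 2 := by
          rw [show m + 2 = m + 1 - 2 ^ i + 1 + 2 ^ i by omega]
          simp
        simp only [this, h, and_true]
        ring
      · rw [if_neg (by omega), if_neg (fun h' => h h'.2)]; ring
    have x0 : xfun 0 (k + 1) = 0 := by rw [xfun]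
    have xN : xfun (N + 1) (k + 1) = 0 := xfun_eq_zero _ _ (by omega)
    have e3 : ∑ m ∈ Finset.range (N + 1), (xfun m (k + 1) : ℝ) * tiltR m u =
        ∑ m ∈ Finset.range (N + 1), (xfun (m + 1) (k + 1) : ℝ) * tiltR (m + 1) u := by
      rw [Finset.sum_range_succ', Finset.sum_range_succ _ N, x0, xN]
      simp
    rw [Finset.sum_congr rfl e2, Finset.sum_comm, e3, Finset.mul_sum, ← Finset.sum_add_distrib,
      pow_succ, ih (N + 1) u (by omega), Finset.sum_mul]
    apply Finset.sum_congr rfl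
    intro m hm
    rw [← Finset.mul_sum]
    linear_combination (xfun (m + 1) (k + 1) : ℝ) *
      tiltR_column m (N + 1) u (by simpa using hm)

lemma tiltR_neg (m : ℕ) (u : ℝ) : tiltR m (-u) = (-1) ^ m * tiltR m u := by
  rcases Nat.eq_zero_or_pos m with rfl | hm
  · simp [tiltR_zero]
  obtain ⟨m, rfl⟩ : ∃ m', m = m' + 1 := ⟨m - 1, by omega⟩
  rcases Nat.even_or_odd' m with ⟨m, rfl | rfl⟩
  · rw [tiltR_odd, tiltR_odd, neg_sq, pow_succ (-1 : ℝ), pow_mul (-1 : ℝ)]; simp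
  · rw [show 2 * m + 1 + 1 = 2 * m + 2 from rfl, tiltR_even, tiltR_even, neg_sq,
      show 2 * m + 2 = 2 * (m + 1) by ring, pow_mul]; simp

lemma trig_sum (s : ℕ) : ∀ m : ℕ, ∑ j ∈ Finset.range (2 ^ s),
    (-1 : ℝ) ^ j * Real.sin ((2 * (j : ℝ) + 1) * π / 2 ^ (s + 1)) *
      tiltR m (2 * Real.cos ((2 * (j : ℝ) + 1) * π / 2 ^ (s + 1))) =
    if m + 1 = 2 ^ s then 2 ^ s else 0 := by
  induction s with
  | zero =>
    intro m
    rcases Nat.eq_zero_or_pos m with rfl | hm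
    · simp [tiltR_zero]
    · obtain ⟨m, rfl⟩ : ∃ m', m = m' + 1 := ⟨m - 1, by omega⟩
      simp only [pow_zero, Finset.range_one, Finset.sum_singleton, Nat.cast_zero, zero_add, pow_one,
        mul_zero, one_mul, Real.cos_pi_div_two]
      rw [if_neg (by omega), tiltR]
      split_ifs <;> simp
  | succ s ih =>
    intro m
    have hs : (2 : ℕ) ^ (s + 1) = 2 ^ s + 2 ^ s := by ring
    have key : ∀ j ∈ Finset.range (2 ^ s),
        (-1 : ℝ) ^ (2 ^ s + (2 ^ s - 1 - j)) *
          Real.sin ((2 * ((2 ^ s + (2 ^ s - 1 - j) : ℕ) : ℝ) + 1) * π / 2 ^ (s + 1 + 1)) *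
          tiltR m (2 * Real.cos ((2 * ((2 ^ s + (2 ^ s - 1 - j) : ℕ) : ℝ) + 1) * π /
            2 ^ (s + 1 + 1))) =
        (-1) ^ (m + 1) * ((-1 : ℝ) ^ j * Real.sin ((2 * (j : ℝ) + 1) * π / 2 ^ (s + 1 + 1)) *
          tiltR m (2 * Real.cos ((2 * (j : ℝ) + 1) * π / 2 ^ (s + 1 + 1)))) := by
      intro j hj
      simp only [Finset.mem_range] at hj
      have ec : ((2 ^ s + (2 ^ s - 1 - j) : ℕ) : ℝ) = 2 ^ (s + 1) - 1 - j := by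
        have : (2 ^ s + (2 ^ s - 1 - j)) + 1 + j = 2 ^ (s + 1) := by omega
        have h2 : (((2 ^ s + (2 ^ s - 1 - j)) + 1 + j : ℕ) : ℝ) = ((2 ^ (s + 1) : ℕ) : ℝ) := by
          rw [this]
        rw [Nat.cast_add _ j, Nat.cast_add _ 1, Nat.cast_one, Nat.cast_pow 2 (s + 1),
          Nat.cast_two] at h2
        linarith
      have ea : (2 * ((2 ^ s + (2 ^ s - 1 - j) : ℕ) : ℝ) + 1) * π / 2 ^ (s + 1 + 1) =
          π - (2 * (j : ℝ) + 1) * π / 2 ^ (s + 1 + 1) := by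
        rw [ec]
        field_simp
        ring
      have es : (-1 : ℝ) ^ (2 ^ s + (2 ^ s - 1 - j)) = - (-1) ^ j := by
        rcases Nat.even_or_odd j with h | h
        · rw [h.neg_one_pow, Odd.neg_one_pow]
          rw [Nat.odd_iff]; rw [Nat.even_iff] at h; omega
        · rw [h.neg_one_pow, Even.neg_one_pow]
          · ring
          rw [Nat.even_iff]; rw [Nat.odd_iff] at h; omega
      rw [ea, Real.sin_pi_sub, Real.cos_pi_sub, mul_neg, tiltR_neg, es]
      ring
    rw [hs, Finset.sum_range_add,
      ← Finset.sum_range_reflect (fun x => (-1 : ℝ) ^ (2 ^ s + x) *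
          Real.sin ((2 * ((2 ^ s + x : ℕ) : ℝ) + 1) * π / 2 ^ (s + 1 + 1)) *
          tiltR m (2 * Real.cos ((2 * ((2 ^ s + x : ℕ) : ℝ) + 1) * π / 2 ^ (s + 1 + 1)))),
      Finset.sum_congr rfl key, ← Finset.mul_sum, ← hs]
    rcases Nat.even_or_odd' m with ⟨m, rfl | rfl⟩
    · rw [if_neg (by omega), pow_succ (-1 : ℝ), pow_mul (-1 : ℝ)]; simp
    · have e : ∀ j ∈ Finset.range (2 ^ s),
        (-1 : ℝ) ^ j * Real.sin ((2 * (j : ℝ) + 1) * π / 2 ^ (s + 1 + 1)) *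
          tiltR (2 * m + 1) (2 * Real.cos ((2 * (j : ℝ) + 1) * π / 2 ^ (s + 1 + 1))) =
        (-1 : ℝ) ^ j * Real.sin ((2 * (j : ℝ) + 1) * π / 2 ^ (s + 1)) *
          tiltR m (2 * Real.cos ((2 * (j : ℝ) + 1) * π / 2 ^ (s + 1))) := by
        intro j _
        have ea : (2 * (j : ℝ) + 1) * π / 2 ^ (s + 1) =
            2 * ((2 * (j : ℝ) + 1) * π / 2 ^ (s + 1 + 1)) := by
          field_simp
          ring
        rw [ea, Real.sin_two_mul, Real.cos_two_mul, tiltR_odd]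
        rw [show ∀ c : ℝ, (2 * c) ^ 2 - 2 = 2 * (2 * c ^ 2 - 1) by intro c; ring]
        ring
      rw [Finset.sum_congr rfl e, ih m, show 2 * m + 1 + 1 = 2 * (m + 1) by ring, pow_mul]
      by_cases h : m + 1 = 2 ^ s
      · rw [if_pos h, if_pos (by omega)]; norm_num; ring
      · rw [if_neg h, if_neg (by omega)]; simp

theorem coefficient_formula (s k : ℕ) (hk : 2 ^ s ≤ k) :
    (xfun (2 ^ s) k : ℝ) =
      (2 : ℝ) ^ (-(s : ℤ)) *
        ∑ j ∈ Finset.range (2 ^ s),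
          (-1) ^ j * Real.sin ((2 * (j : ℝ) + 1) * π / 2 ^ (s + 1)) *
            (2 + 2 * Real.cos ((2 * (j : ℝ) + 1) * π / 2 ^ (s + 1))) ^ (k - 1) := by
  obtain ⟨k, rfl⟩ : ∃ k', k = k' + 1 :=
    ⟨k - 1, by have := Nat.one_le_two_pow (n := s); omega⟩
  rw [Nat.add_sub_cancel]
  have h1 := Nat.one_le_two_pow (n := s)
  have e : ∀ j ∈ Finset.range (2 ^ s),
      (-1 : ℝ) ^ j * Real.sin ((2 * (j : ℝ) + 1) * π / 2 ^ (s + 1)) *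
            (2 + 2 * Real.cos ((2 * (j : ℝ) + 1) * π / 2 ^ (s + 1))) ^ k =
      ∑ m ∈ Finset.range (k + 1), (xfun (m + 1) (k + 1) : ℝ) *
        ((-1 : ℝ) ^ j * Real.sin ((2 * (j : ℝ) + 1) * π / 2 ^ (s + 1)) *
          tiltR m (2 * Real.cos ((2 * (j : ℝ) + 1) * π / 2 ^ (s + 1)))) := by
    intro j _
    rw [add_comm (2 : ℝ), pow_expand k (k + 1) _ (by omega), Finset.mul_sum]
    apply Finset.sum_congr rfl
    intro m _
    ring
  rw [Finset.sum_congr rfl e, Finset.sum_comm]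
  simp_rw [← Finset.mul_sum, trig_sum]
  rw [Finset.sum_eq_single (2 ^ s - 1)]
  · rw [show 2 ^ s - 1 + 1 = 2 ^ s by omega, if_pos rfl, zpow_neg, zpow_natCast]
    field_simp
  · intro m _ hm
    rw [if_neg (by omega), mul_zero]
  · intro h
    simp only [Finset.mem_range] at h
    omega
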